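/- arXiv:0903.3144 — 2 statements merged into one kernel-verified Lean document; each statement's English description precedes it below -/
import Mathlib

section
/- Let T > 0, 0 < R ≤ 1, let φ̃₀ ∈ ℝ, and let φ, φ̃ : ℝ → ℝ be continuous T-periodic functions satisfying the projected time-delayed feedback recursion φ̃(t) = (1 − R)·φ̃(t − T) + R·(φ(t − T) − avg[φ(t − T − ·)]) for all t ∈ ℝ, where avg[φ(t − ·)] = (1/T)·∫₀ᵀ φ(t − s) ds. Then φ̃(t) = φ(t) − (1/T)·∫₀ᵀ φ(s) ds for all t, and consequently the control input u(t) = φ(t) − φ̃(t) − φ̃₀ is constant and equal to (1/T)·∫₀ᵀ φ(s) ds − φ̃₀; in particular u ≡ 0 if and only if (1/T)·∫₀ᵀ φ(s) ds = φ̃₀. -/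
open intervalIntegral

/-- Projected time-delayed feedback on `T`-periodic signals: if the continuous
`T`-periodic functions `φ`, `φ̃` satisfy the recursion
`φ̃ t = (1 - R) * φ̃ (t - T) + R * (φ (t - T) - avg[φ (t - T - ·)])` with
`0 < R ≤ 1`, where `avg[φ (t - ·)] = (1/T) * ∫ s in 0..T, φ (t - s)`, then
`φ̃ t = φ t - (1/T) * ∫ s in 0..T, φ s` for all `t`; consequently the control
input `u t = φ t - φ̃ t - φ̃₀` is constant, equal to
`(1/T) * ∫ s in 0..T, φ s - φ̃₀`, and `u ≡ 0` iff the mean of `φ` equals `φ̃₀`. -/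
theorem ptdf_periodic_reference
    (T R φt₀ : ℝ) (hT : 0 < T) (hR0 : 0 < R) (hR1 : R ≤ 1)
    (φ φt : ℝ → ℝ)
    (hφc : Continuous φ) (hφtc : Continuous φt)
    (hφ : Function.Periodic φ T) (hφt : Function.Periodic φt T)
    (hrec : ∀ t : ℝ, φt t =
      (1 - R) * φt (t - T) +
        R * (φ (t - T) - (1 / T) * ∫ s in (0:ℝ)..T, φ (t - T - s))) :
    (∀ t : ℝ, φt t = φ t - (1 / T) * ∫ s in (0:ℝ)..T, φ s) ∧
    (∀ t : ℝ, φ t - φt t - φt₀ = (1 / T) * (∫ s in (0:ℝ)..T, φ s) - φt₀) ∧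
    ((∀ t : ℝ, φ t - φt t - φt₀ = 0) ↔
      (1 / T) * ∫ s in (0:ℝ)..T, φ s = φt₀) := by
  have hint : ∀ t : ℝ, ∫ s in (0:ℝ)..T, φ (t - T - s) = ∫ s in (0:ℝ)..T, φ s := by
    intro t
    rw [intervalIntegral.integral_comp_sub_left (fun x => φ x) (t - T)]
    have h := hφ.intervalIntegral_add_eq (t - T - T) 0
    simpa using h
  have h1 : ∀ t : ℝ, φt t = φ t - (1 / T) * ∫ s in (0:ℝ)..T, φ s := by
    intro t
    have h := hrec t
    rw [hint, hφ.sub_eq, hφt.sub_eq] at h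
    apply mul_left_cancel₀ hR0.ne'
    linarith
  refine ⟨h1, fun t => by rw [h1 t]; ring, fun h => ?_, fun h t => ?_⟩
  · have h0 := h 0
    rw [h1 0] at h0
    linarith
  · rw [h1 t]
    linarith
end

section
/- Let m, l, ω > 0, b, g, p ∈ ℝ, and T = 2π/ω. If φ : ℝ → ℝ is a twice continuously differentiable T-periodic solution of the rotating-coordinates pendulum equation m l² φ''(t) + b φ'(t) + b ω + m l (g + ω² p sin(ω t)) sin(φ(t) + ω t) = 0, then the integral balance ∫₀ᵀ [b ω + m l (g + ω² p sin(ω t)) sin(φ(t) + ω t)] dt = 0 holds, and consequently b ω ≤ m l (|g| + ω² |p|). -/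
open Real intervalIntegral

/-- Integral balance for `T`-periodic rotations of the excited pendulum: if
`φ` is a `C²` `T`-periodic solution of
`m l² φ'' + b φ' + b ω + m l (g + ω² p sin (ω t)) sin (φ + ω t) = 0`, then
`∫ t in 0..T, (b ω + m l (g + ω² p sin (ω t)) sin (φ t + ω t)) = 0`, and
consequently `b ω ≤ m l (|g| + ω² |p|)`. -/
theorem pendulum_integral_balance
    (m l ω : ℝ) (hm : 0 < m) (hl : 0 < l) (hω : 0 < ω)
    (b g p : ℝ) (T : ℝ) (hT : T = 2 * π / ω)
    (φ : ℝ → ℝ) (hφ : ContDiff ℝ 2 φ) (hper : Function.Periodic φ T)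
    (hode : ∀ t : ℝ,
      m * l ^ 2 * deriv (deriv φ) t + b * deriv φ t + b * ω +
          m * l * (g + ω ^ 2 * p * Real.sin (ω * t)) * Real.sin (φ t + ω * t) =
        0) :
    (∫ t in (0:ℝ)..T,
        (b * ω +
          m * l * (g + ω ^ 2 * p * Real.sin (ω * t)) *
            Real.sin (φ t + ω * t))) = 0 ∧
    b * ω ≤ m * l * (|g| + ω ^ 2 * |p|) := by
  have hd1 : Differentiable ℝ φ := hφ.differentiable (by norm_num)
  have hφ' : ContDiff ℝ 1 (deriv φ) := by
    have h : ContDiff ℝ (1 + 1) φ := by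
      rw [one_add_one_eq_two]
      exact hφ
    exact (contDiff_succ_iff_deriv.1 h).2.2
  have hd2 : Differentiable ℝ (deriv φ) := hφ'.differentiable (by norm_num)
  have hcφ : Continuous φ := hd1.continuous
  have hcont : Continuous (fun t : ℝ => b * ω +
      m * l * (g + ω ^ 2 * p * Real.sin (ω * t)) * Real.sin (φ t + ω * t)) := by
    fun_prop
  have hTpos : 0 < T := by
    rw [hT]
    positivity
  have hper' : deriv φ T = deriv φ 0 := by
    have h : (fun t => φ (t + T)) = φ := funext hper
    have h2 := deriv_comp_add_const φ T 0
    rw [h, zero_add] at h2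
    exact h2.symm
  have hper0 : φ T = φ 0 := by
    have h := hper 0
    rwa [zero_add] at h
  have hint : (∫ t in (0:ℝ)..T,
        (b * ω +
          m * l * (g + ω ^ 2 * p * Real.sin (ω * t)) *
            Real.sin (φ t + ω * t))) = 0 := by
    rw [integral_eq_sub_of_hasDerivAt
      (f := fun t => -(m * l ^ 2 * deriv φ t + b * φ t)) _ (hcont.intervalIntegrable _ _)]
    · simp only [hper', hper0, sub_self]
    · intro t _
      have h := (((hd2 t).hasDerivAt.const_mul (m * l ^ 2)).add
        ((hd1 t).hasDerivAt.const_mul b)).neg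
      refine HasDerivAt.congr_deriv (f := fun t => -(m * l ^ 2 * deriv φ t + b * φ t)) h ?_
      linarith [hode t]
  refine ⟨hint, ?_⟩
  by_contra! hlt
  have hbound : ∀ t : ℝ, 0 < b * ω +
      m * l * (g + ω ^ 2 * p * Real.sin (ω * t)) * Real.sin (φ t + ω * t) := by
    intro t
    have h1 : |m * l * (g + ω ^ 2 * p * Real.sin (ω * t)) * Real.sin (φ t + ω * t)|
        ≤ m * l * (|g| + ω ^ 2 * |p|) := by
      have hA : |g + ω ^ 2 * p * Real.sin (ω * t)| ≤ |g| + ω ^ 2 * |p| := by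
        refine (abs_add_le _ _).trans ?_
        rw [abs_mul, abs_mul, abs_of_pos (pow_pos hω 2)]
        have := mul_le_of_le_one_right (a := ω ^ 2 * |p|) (by positivity)
          (Real.abs_sin_le_one (ω * t))
        linarith
      rw [abs_mul, abs_mul, abs_of_pos (mul_pos hm hl)]
      refine (mul_le_of_le_one_right (by positivity) (Real.abs_sin_le_one _)).trans ?_
      exact mul_le_mul_of_nonneg_left hA (mul_pos hm hl).le
    linarith [neg_le_of_abs_le h1]
  have hpos := intervalIntegral_pos_of_pos (hcont.intervalIntegrable 0 T) hbound hTpos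
  exact absurd hint hpos.ne'
end
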